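/- arXiv:2602.07318 — 7 statements merged into one kernel-verified Lean document; each statement's English description precedes it below -/
import Mathlib

section
/- Let R ≥ R₀ := √(2/π). Then the value V := sup_{𝓖 ⊆ σ(X)} E[R·|E[X|𝓖]| + (1/2)·Var(X|𝓖)] equals R₀·R − 1/π + 1/2, and the supremum is attained at 𝓖* := σ({X > 0}), i.e. u(σ({X > 0})) = R₀·R − 1/π + 1/2. -/
open MeasureTheory ProbabilityTheory

/-- The insider's objective `u(𝓖) = E[R·|E[X|𝓖]| + (1/2)·Var(X|𝓖)]`, where
`Var(X|𝓖) = E[X²|𝓖] − (E[X|𝓖])²`. -/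
noncomputable def infoValue {Ω : Type*} {m0 : MeasurableSpace Ω} (P : Measure Ω) (X : Ω → ℝ)
    (R : ℝ) (G : MeasurableSpace Ω) : ℝ :=
  ∫ ω, (R * |(P[X|G]) ω| +
    (1 / 2) * ((P[(fun ω' => (X ω') ^ 2)|G]) ω - ((P[X|G]) ω) ^ 2)) ∂P

lemma integral_abs_gaussianReal_zero_one :
    ∫ x, |x| ∂(gaussianReal 0 1) = Real.sqrt (2 / Real.pi) := by
  have hhalf : ∫ x in Set.Ioi (0 : ℝ), x * Real.exp (-(1 / 2) * x ^ 2) = 1 := by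
    have h := integral_rpow_mul_exp_neg_mul_rpow (p := 2) (q := 1) (b := 1 / 2)
      (by norm_num) (by norm_num) (by norm_num)
    norm_num [Real.rpow_neg_one] at h
    norm_num
    exact h
  have hpdf : ∀ x : ℝ, gaussianPDFReal 0 1 x • |x| =
      (Real.sqrt (2 * Real.pi))⁻¹ * (|x| * Real.exp (-(1 / 2) * |x| ^ 2)) := by
    intro x
    simp only [gaussianPDFReal, smul_eq_mul, sq_abs, NNReal.coe_one, mul_one, sub_zero]
    ring_nf
  rw [integral_gaussianReal_eq_integral_smul one_ne_zero]
  simp_rw [hpdf]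
  rw [integral_const_mul, integral_comp_abs (f := fun x => x * Real.exp (-(1 / 2) * x ^ 2)),
    hhalf, Real.sqrt_div zero_le_two, Real.sqrt_mul zero_le_two]
  have h2 : Real.sqrt 2 ^ 2 = 2 := Real.sq_sqrt zero_le_two
  have hpi : 0 < Real.sqrt Real.pi := Real.sqrt_pos.2 Real.pi_pos
  field_simp
  exact h2.symm

lemma integral_sq_gaussianReal_zero_one : ∫ x, x ^ 2 ∂(gaussianReal 0 1) = 1 := by
  have h := variance_fun_id_gaussianReal (μ := 0) (v := 1)
  rw [variance_eq_integral (by fun_prop)] at h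
  simpa using h

lemma gaussianReal_zero_one_real_Ioi : (gaussianReal 0 1).real (Set.Ioi 0) = 1 / 2 := by
  have hsymm : (gaussianReal 0 1).real (Set.Iio 0) = (gaussianReal 0 1).real (Set.Ioi 0) := by
    have hmap : (gaussianReal 0 1).map (fun x => -x) = gaussianReal 0 1 := by
      simpa using gaussianReal_map_neg (μ := 0) (v := 1)
    conv_rhs => rw [← hmap]
    rw [map_measureReal_apply measurable_neg measurableSet_Ioi]
    simp
  have := nullSingletonClass_gaussianReal (μ := 0) (v := 1) one_ne_zero
  have hIic : (gaussianReal 0 1).real (Set.Iic 0) = (gaussianReal 0 1).real (Set.Iio 0) :=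
    measureReal_congr Iio_ae_eq_Iic.symm
  have hcompl := probReal_compl_eq_one_sub (μ := gaussianReal 0 1)
    (measurableSet_Ioi (a := (0 : ℝ)))
  rw [Set.compl_Ioi, hIic, hsymm] at hcompl
  linarith

lemma infoValue_eq_integral_abs_sub_integral_sq {Ω : Type*} {m0 : MeasurableSpace Ω}
    {P : Measure Ω} [IsProbabilityMeasure P] {X : Ω → ℝ} (hX : MemLp X 2 P) (R : ℝ)
    {G : MeasurableSpace Ω} (hG : G ≤ m0) :
    infoValue P X R G = R * ∫ ω, |(P[X|G]) ω| ∂P +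
      (1 / 2) * (∫ ω, X ω ^ 2 ∂P - ∫ ω, (P[X|G]) ω ^ 2 ∂P) := by
  have hsq : Integrable (fun ω => (P[X|G]) ω ^ 2) P := (hX.condExp one_le_two).integrable_sq
  have habs : Integrable (fun ω => |(P[X|G]) ω|) P := integrable_condExp.abs
  have hvar : Integrable (fun ω => (P[fun ω' => X ω' ^ 2|G]) ω - (P[X|G]) ω ^ 2) P :=
    integrable_condExp.sub hsq
  unfold infoValue
  rw [integral_add (habs.const_mul R) (hvar.const_mul (1 / 2)), integral_const_mul,
    integral_const_mul, integral_sub integrable_condExp hsq, integral_condExp hG]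

lemma sq_integral_abs_le_integral_sq {Ω : Type*} {m0 : MeasurableSpace Ω}
    {P : Measure Ω} [IsProbabilityMeasure P] {Y : Ω → ℝ} (hY : MemLp Y 2 P) :
    (∫ ω, |Y ω| ∂P) ^ 2 ≤ ∫ ω, Y ω ^ 2 ∂P := by
  have h := variance_nonneg |Y| P
  rw [variance_eq_sub hY.abs] at h
  simpa using h

lemma condExp_generateFrom_pos_ae_eq {Ω : Type*} {m0 : MeasurableSpace Ω}
    {P : Measure Ω} [IsProbabilityMeasure P] {X : Ω → ℝ} (hX : Measurable X)
    (hint : Integrable X P) (hmean : ∫ ω, X ω ∂P = 0) (hhalf : P.real {ω | 0 < X ω} = 1 / 2) :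
    P[X|MeasurableSpace.generateFrom {{ω | 0 < X ω}}] =ᵐ[P]
      fun ω => if 0 < X ω then ∫ ω, |X ω| ∂P else -∫ ω, |X ω| ∂P := by
  set c := ∫ ω, |X ω| ∂P
  set A := {ω | 0 < X ω} with hA
  have hAmeas : MeasurableSet A := measurableSet_lt measurable_const hX
  have hAgen : MeasurableSet[MeasurableSpace.generateFrom {A}] A :=
    MeasurableSpace.measurableSet_generateFrom rfl
  have hle := MeasurableSpace.generateFrom_singleton_le hAmeas
  set g : Ω → ℝ := fun ω => if 0 < X ω then c else -c with hg
  have hgm : StronglyMeasurable[MeasurableSpace.generateFrom {A}] g :=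
    StronglyMeasurable.ite hAgen stronglyMeasurable_const stronglyMeasurable_const
  have hgint : Integrable g P := by
    refine Integrable.of_bound (hgm.mono hle).aestronglyMeasurable |c| (ae_of_all _ fun ω => ?_)
    by_cases h : 0 < X ω <;> simp [hg, h]
  have hXA : ∫ ω in A, X ω ∂P = c / 2 := by
    have hpt : ∀ ω, A.indicator X ω = (|X ω| + X ω) / 2 := by
      intro ω
      by_cases h : 0 < X ω
      · simp [hA, h, abs_of_pos h]
      · simp [hA, h, abs_of_nonpos (not_lt.1 h)]
    rw [← integral_indicator hAmeas]
    simp_rw [hpt]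
    rw [integral_div, integral_add hint.abs hint, hmean, add_zero]
  have hgA : ∫ ω in A, g ω ∂P = c / 2 := by
    rw [setIntegral_congr_fun hAmeas (f := g) (g := fun _ => c) (fun ω hω => if_pos hω),
      setIntegral_const, hhalf, smul_eq_mul]
    ring
  have hgAc : ∫ ω in Aᶜ, g ω ∂P = -(c / 2) := by
    rw [setIntegral_congr_fun hAmeas.compl (f := g) (g := fun _ => -c) (fun ω hω => if_neg hω),
      setIntegral_const, probReal_compl_eq_one_sub hAmeas, hhalf, smul_eq_mul]
    ring
  have hXAc : ∫ ω in Aᶜ, X ω ∂P = -(c / 2) := by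
    have h := integral_add_compl hAmeas hint
    linarith
  have hguniv : ∫ ω, g ω ∂P = 0 := by
    rw [← integral_add_compl hAmeas hgint, hgA, hgAc, add_neg_cancel]
  refine (ae_eq_condExp_of_forall_setIntegral_eq hle hint (fun s _ _ => hgint.integrableOn)
    (fun s hs _ => ?_) hgm.aestronglyMeasurable).symm
  obtain rfl | rfl | rfl | rfl := measurableSet_generateFrom_singleton_iff.1 hs
  · simp
  · rw [hgA, hXA]
  · rw [hgAc, hXAc]
  · rw [setIntegral_univ, setIntegral_univ, hguniv, hmean]

/-- If `R ≥ R₀ := √(2/π)`, then `V = sup_{𝓖 ⊆ σ(X)} u(𝓖) = R₀·R − 1/π + 1/2`, attained at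
`𝓖* = σ({X > 0})`. -/
theorem insider_value_large_R {Ω : Type*} {m0 : MeasurableSpace Ω}
    (P : Measure Ω) [IsProbabilityMeasure P]
    (X : Ω → ℝ) (hX : Measurable X)
    (hlaw : P.map X = gaussianReal 0 1)
    (R : ℝ) (hR : Real.sqrt (2 / Real.pi) ≤ R) :
    (∀ G : MeasurableSpace Ω, G ≤ MeasurableSpace.comap X Real.measurableSpace →
      infoValue P X R G ≤ Real.sqrt (2 / Real.pi) * R - 1 / Real.pi + 1 / 2) ∧
    infoValue P X R (MeasurableSpace.generateFrom {{ω | 0 < X ω}}) =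
      Real.sqrt (2 / Real.pi) * R - 1 / Real.pi + 1 / 2 := by
  have hlp : MemLp X 2 P := by
    have h := memLp_id_gaussianReal' (μ := 0) (v := 1) 2 (by simp)
    rw [← hlaw] at h
    exact h.comp_of_map hX.aemeasurable
  have hmean : ∫ ω, X ω ∂P = 0 := by
    rw [← integral_map (f := fun x => x) hX.aemeasurable (by fun_prop), hlaw,
      integral_id_gaussianReal]
  have habs : ∫ ω, |X ω| ∂P = Real.sqrt (2 / Real.pi) := by
    rw [← integral_map (f := fun x => |x|) hX.aemeasurable (by fun_prop), hlaw,
      integral_abs_gaussianReal_zero_one]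
  have hsq : ∫ ω, X ω ^ 2 ∂P = 1 := by
    rw [← integral_map (f := fun x => x ^ 2) hX.aemeasurable (by fun_prop), hlaw,
      integral_sq_gaussianReal_zero_one]
  have hhalf : P.real {ω | 0 < X ω} = 1 / 2 := by
    rw [← gaussianReal_zero_one_real_Ioi, ← hlaw, map_measureReal_apply hX measurableSet_Ioi]
    rfl
  have hR₀ : Real.sqrt (2 / Real.pi) ^ 2 = 2 * (1 / Real.pi) := by
    rw [Real.sq_sqrt (by positivity)]
    ring
  constructor
  · intro G hG
    rw [infoValue_eq_integral_abs_sub_integral_sq hlp R (hG.trans hX.comap_le), hsq]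
    have hcontr : ∫ ω, |(P[X|G]) ω| ∂P ≤ Real.sqrt (2 / Real.pi) :=
      (integral_abs_condExp_le X).trans_eq habs
    have hjensen := sq_integral_abs_le_integral_sq (hlp.condExp (m := G) one_le_two)
    nlinarith [mul_nonneg (sub_nonneg.2 hcontr) (sub_nonneg.2 hR), sq_nonneg
      (Real.sqrt (2 / Real.pi) - ∫ ω, |(P[X|G]) ω| ∂P)]
  · have hle := MeasurableSpace.generateFrom_singleton_le
      (measurableSet_lt measurable_const hX : MeasurableSet {ω | 0 < X ω})
    have hcond := condExp_generateFrom_pos_ae_eq hX (hlp.integrable one_le_two) hmean hhalf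
    rw [habs] at hcond
    have hcondabs : (fun ω => |(P[X|MeasurableSpace.generateFrom {{ω | 0 < X ω}}]) ω|) =ᵐ[P]
        fun _ => Real.sqrt (2 / Real.pi) := by
      filter_upwards [hcond] with ω hω
      rw [hω]
      split_ifs <;> simp only [abs_neg, abs_of_nonneg (Real.sqrt_nonneg _)]
    have hcondsq : (fun ω => (P[X|MeasurableSpace.generateFrom {{ω | 0 < X ω}}]) ω ^ 2) =ᵐ[P]
        fun _ => 2 * (1 / Real.pi) := by
      filter_upwards [hcondabs] with ω hω
      rw [← hR₀, ← hω, sq_abs]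
    rw [infoValue_eq_integral_abs_sub_integral_sq hlp R hle, hsq, integral_congr_ae hcondabs,
      integral_congr_ae hcondsq, integral_const, integral_const, probReal_univ, one_smul, one_smul]
    ring
end

section
/- Let 0 < R < R₀ := √(2/π). Then the value V := sup_{𝓖 ⊆ σ(X)} E[R·|E[X|𝓖]| + (1/2)·Var(X|𝓖)] equals R²/2 + 1/2, and the supremum is attained at 𝓖* := σ(E_{a_R}), where a_R > 0 is the unique positive number with I(a_R) = R. -/
open MeasureTheory ProbabilityTheory

/-- `I(a) = R₀ − 2·E[|X|·1_{|X| ≤ a}]` with `R₀ = √(2/π)`. -/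
noncomputable def Ifun {Ω : Type*} {m0 : MeasurableSpace Ω} (P : Measure Ω) (X : Ω → ℝ)
    (a : ℝ) : ℝ :=
  Real.sqrt (2 / Real.pi) - 2 * ∫ ω in {ω | |X ω| ≤ a}, |X ω| ∂P

/-- `E_a = {−a < X < 0} ∪ {X > a}`. -/
def Eset {Ω : Type*} (X : Ω → ℝ) (a : ℝ) : Set Ω :=
  {ω | -a < X ω ∧ X ω < 0} ∪ {ω | a < X ω}

open Set Filter Topology

lemma setIntegral_Ioi_id_gaussianReal (a : ℝ) :
    ∫ x in Ioi a, x ∂gaussianReal 0 1 = √(2 / Real.pi) / 2 * Real.exp (-a ^ 2 / 2) := by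
  have hc : √(2 / Real.pi) / 2 = (√(2 * Real.pi))⁻¹ := by
    have h2 : (0 : ℝ) < 2 := two_pos
    rw [Real.sqrt_div h2.le, Real.sqrt_mul h2.le]
    have := Real.sqrt_pos.2 Real.pi_pos
    have := Real.sqrt_pos.2 h2
    field_simp
    rw [Real.sq_sqrt h2.le]
  have hintegral : Integrable fun x : ℝ ↦ x * Real.exp (-x ^ 2 / 2) := by
    refine (integrable_mul_exp_neg_mul_sq (b := 1 / 2) (by norm_num)).congr (ae_of_all _ fun x ↦ ?_)
    simp only
    congr 2
    ring
  have hlim : Tendsto (fun x : ℝ ↦ -Real.exp (-x ^ 2 / 2)) atTop (𝓝 0) := by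
    rw [← neg_zero]
    refine (Real.tendsto_exp_atBot.comp ?_).neg
    simp_rw [neg_div]
    exact tendsto_neg_atTop_atBot.comp
      ((tendsto_pow_atTop two_ne_zero).atTop_div_const two_pos)
  have hderiv (x : ℝ) :
      HasDerivAt (fun x : ℝ ↦ -Real.exp (-x ^ 2 / 2)) (x * Real.exp (-x ^ 2 / 2)) x := by
    have h := (((hasDerivAt_pow 2 x).neg.div_const 2).exp).neg
    refine h.congr_deriv ?_
    simp
    ring
  rw [← integral_indicator measurableSet_Ioi, integral_gaussianReal_eq_integral_smul one_ne_zero]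
  have hind : (fun x ↦ gaussianPDFReal 0 1 x • (Ioi a).indicator (fun x ↦ x) x) =
      (Ioi a).indicator fun x ↦ (√(2 * Real.pi))⁻¹ * (x * Real.exp (-x ^ 2 / 2)) := by
    ext x
    by_cases hx : x ∈ Ioi a <;> simp [hx, gaussianPDFReal]
    ring
  rw [hind, integral_indicator measurableSet_Ioi, integral_const_mul,
    integral_Ioi_of_hasDerivAt_of_tendsto' (fun x _ ↦ hderiv x) hintegral.integrableOn hlim, hc]
  ring

lemma integrable_id_gaussianReal : Integrable (fun x : ℝ ↦ x) (gaussianReal 0 1) :=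
  (memLp_id_gaussianReal 1).integrable le_rfl

lemma setIntegral_Ioc_id_gaussianReal {a b : ℝ} (hab : a ≤ b) :
    ∫ x in Ioc a b, x ∂gaussianReal 0 1 =
      √(2 / Real.pi) / 2 * (Real.exp (-a ^ 2 / 2) - Real.exp (-b ^ 2 / 2)) := by
  have h := setIntegral_union (μ := gaussianReal 0 1) (f := fun x : ℝ ↦ x)
    (Ioc_disjoint_Ioi_same (a := a) (b := b)) measurableSet_Ioi
    integrable_id_gaussianReal.integrableOn integrable_id_gaussianReal.integrableOn
  rw [Ioc_union_Ioi_eq_Ioi hab, setIntegral_Ioi_id_gaussianReal,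
    setIntegral_Ioi_id_gaussianReal] at h
  linarith

instance : NullSingletonClass (gaussianReal 0 1) :=
  nullSingletonClass_gaussianReal one_ne_zero

lemma setIntegral_abs_gaussianReal {a : ℝ} (ha : 0 ≤ a) :
    ∫ x in {x | |x| ≤ a}, |x| ∂gaussianReal 0 1 =
      √(2 / Real.pi) * (1 - Real.exp (-a ^ 2 / 2)) := by
  have hset : {x : ℝ | |x| ≤ a} = Icc (-a) a := by
    ext x
    simp [abs_le]
  have hintegral := integrable_id_gaussianReal.abs
  rw [hset, integral_Icc_eq_integral_Ioc, ← Ioc_union_Ioc_eq_Ioc (neg_nonpos.2 ha) ha,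
    setIntegral_union (Ioc_disjoint_Ioc_of_le le_rfl) measurableSet_Ioc hintegral.integrableOn
      hintegral.integrableOn,
    setIntegral_congr_fun (g := fun x ↦ -x) measurableSet_Ioc fun x hx ↦ abs_of_nonpos hx.2,
    setIntegral_congr_fun (g := fun x ↦ x) measurableSet_Ioc fun x hx ↦ abs_of_pos hx.1,
    integral_neg, setIntegral_Ioc_id_gaussianReal (neg_nonpos.2 ha),
    setIntegral_Ioc_id_gaussianReal ha]
  simp
  ring

lemma setIntegral_Eset_gaussianReal {a : ℝ} (ha : 0 ≤ a) :
    ∫ x in Eset id a, x ∂gaussianReal 0 1 =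
      √(2 / Real.pi) / 2 * (2 * Real.exp (-a ^ 2 / 2) - 1) := by
  have hE : Eset id a = Ioo (-a) 0 ∪ Ioi a := rfl
  have hdisj : Disjoint (Ioo (-a) 0) (Ioi a) :=
    disjoint_left.2 fun x hx hx' ↦ (ha.trans_lt hx').not_gt hx.2
  rw [hE, setIntegral_union hdisj measurableSet_Ioi integrable_id_gaussianReal.integrableOn
      integrable_id_gaussianReal.integrableOn, ← integral_Ioc_eq_integral_Ioo,
    setIntegral_Ioc_id_gaussianReal (neg_nonpos.2 ha), setIntegral_Ioi_id_gaussianReal]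
  simp
  ring

lemma measurableSet_Eset {Ω : Type*} {m0 : MeasurableSpace Ω} {X : Ω → ℝ} (hX : Measurable X)
    (a : ℝ) : MeasurableSet (Eset X a) :=
  (hX measurableSet_Ioo).union (hX measurableSet_Ioi)

lemma measureReal_Eset_gaussianReal {a : ℝ} (ha : 0 ≤ a) :
    (gaussianReal 0 1).real (Eset id a) = 1 / 2 := by
  have hE := measurableSet_Eset measurable_id a
  have hmap : (gaussianReal 0 1).real ((fun x ↦ -x) ⁻¹' Eset id a) =
      (gaussianReal 0 1).real (Eset id a) := by
    rw [← map_measureReal_apply measurable_neg hE, gaussianReal_map_neg, neg_zero]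
  have hcompl : (gaussianReal 0 1).real ((fun x ↦ -x) ⁻¹' Eset id a) =
      (gaussianReal 0 1).real (Eset id a)ᶜ := by
    refine measureReal_congr ?_
    have hfin : ({-a, 0, a} : Set ℝ).Finite := toFinite _
    filter_upwards [hfin.countable.ae_notMem (gaussianReal 0 1)] with x hx
    simp only [mem_insert_iff, mem_singleton_iff, not_or] at hx
    refine propext ?_
    change ((-a < -x ∧ -x < 0) ∨ a < -x) ↔ ¬ ((-a < x ∧ x < 0) ∨ a < x)
    grind
  rw [measureReal_compl hE, probReal_univ] at hcompl
  linarith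

section RandomVariable

variable {Ω : Type*} {m0 : MeasurableSpace Ω} {P : Measure Ω} {X : Ω → ℝ}

lemma Ifun_eq_of_map_eq_gaussianReal (hX : Measurable X) (hlaw : P.map X = gaussianReal 0 1)
    {a : ℝ} (ha : 0 ≤ a) :
    Ifun P X a = √(2 / Real.pi) * (2 * Real.exp (-a ^ 2 / 2) - 1) := by
  have h := setIntegral_map (μ := P) (g := X) (f := fun x : ℝ ↦ |x|)
    (measurableSet_le measurable_id.abs measurable_const : MeasurableSet {x : ℝ | |x| ≤ a})
    (by fun_prop) hX.aemeasurable
  rw [hlaw, setIntegral_abs_gaussianReal ha] at h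
  rw [Ifun, ← preimage_ofPred_eq (f := X) (p := fun x ↦ |x| ≤ a), ← h]
  ring

variable [IsProbabilityMeasure P]

/-- The objective depends on `G` only through the law of `E[X|G]`. -/
lemma infoValue_eq (hX : MemLp X 2 P) (R : ℝ) {G : MeasurableSpace Ω} (hG : G ≤ m0) :
    infoValue P X R G =
      ∫ ω, (R * |(P[X|G]) ω| - (P[X|G]) ω ^ 2 / 2) ∂P + (∫ ω, X ω ^ 2 ∂P) / 2 := by
  have hsq := (hX.condExp (m := G) one_le_two).integrable_sq
  have habs : Integrable (fun ω ↦ |(P[X|G]) ω|) P := integrable_condExp.abs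
  have hdiff : Integrable (fun ω ↦ R * |(P[X|G]) ω| - (P[X|G]) ω ^ 2 / 2) P :=
    (habs.const_mul R).sub (hsq.div_const 2)
  rw [← integral_condExp hG (f := fun ω ↦ X ω ^ 2), ← integral_div,
    ← integral_add hdiff (integrable_condExp.div_const 2), infoValue]
  congr 1 with ω
  ring

lemma infoValue_le (hX : MemLp X 2 P) (R : ℝ) {G : MeasurableSpace Ω} (hG : G ≤ m0) :
    infoValue P X R G ≤ R ^ 2 / 2 + (∫ ω, X ω ^ 2 ∂P) / 2 := by
  have hsq := (hX.condExp (m := G) one_le_two).integrable_sq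
  have habs : Integrable (fun ω ↦ |(P[X|G]) ω|) P := integrable_condExp.abs
  rw [infoValue_eq hX R hG]
  gcongr
  calc ∫ ω, (R * |(P[X|G]) ω| - (P[X|G]) ω ^ 2 / 2) ∂P ≤ ∫ _, R ^ 2 / 2 ∂P := by
        refine integral_mono ((habs.const_mul R).sub (hsq.div_const 2)) (integrable_const _)
          fun ω ↦ ?_
        have := sq_nonneg (R - |(P[X|G]) ω|)
        have := sq_abs ((P[X|G]) ω)
        simp only
        nlinarith
    _ = R ^ 2 / 2 := by simp

/-- The bound of `infoValue_le` is attained as soon as `|E[X|G]| = R` almost surely. -/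
lemma infoValue_eq_of_abs_condExp_eq (hX : MemLp X 2 P) {R : ℝ} {G : MeasurableSpace Ω}
    (hG : G ≤ m0) (h : ∀ᵐ ω ∂P, |(P[X|G]) ω| = R) :
    infoValue P X R G = R ^ 2 / 2 + (∫ ω, X ω ^ 2 ∂P) / 2 := by
  rw [infoValue_eq hX R hG, integral_congr_ae (g := fun _ ↦ R ^ 2 / 2)]
  · simp
  · filter_upwards [h] with ω hω
    rw [← sq_abs, hω]
    ring

/-- A centred random variable has conditional expectation `±R` given an event of probability
`1 / 2` on which its integral is `R / 2`. -/
lemma abs_condExp_generateFrom_singleton_eq (hX : Integrable X P) (h0 : ∫ ω, X ω ∂P = 0)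
    {R : ℝ} (hR : 0 ≤ R) {s : Set Ω} (hs : MeasurableSet s) (hPs : P.real s = 1 / 2)
    (hintegral : ∫ ω in s, X ω ∂P = R / 2) :
    ∀ᵐ ω ∂P, |(P[X|MeasurableSpace.generateFrom {s}]) ω| = R := by
  have hG : MeasurableSpace.generateFrom {s} =
      MeasurableSpace.generateFrom {sᶜ} := by
    ext t
    simp only [measurableSet_generateFrom_singleton_iff, compl_compl]
    tauto
  have hcompl : ∫ ω in sᶜ, X ω ∂P = -(R / 2) := by
    linarith [integral_add_compl hs hX]
  have hPc : P.real sᶜ = 1 / 2 := by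
    rw [probReal_compl_eq_one_sub hs, hPs]
    norm_num
  have hcond (t : Set Ω) (ht : P.real t = 1 / 2) :
      ∫ ω, X ω ∂P[|t] = 2 * ∫ ω in t, X ω ∂P := by
    rw [ProbabilityTheory.cond, integral_smul_measure, ENNReal.toReal_inv, ← measureReal_def, ht]
    simp
  have hon := condExp_generateFrom_singleton hs hX
  have hoff := condExp_generateFrom_singleton hs.compl hX
  rw [hcond s hPs, hintegral] at hon
  rw [← hG, hcond sᶜ hPc, hcompl] at hoff
  refine ae_of_ae_restrict_of_ae_restrict_compl s ?_ ?_
  · filter_upwards [hon] with ω hω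
    rw [hω, abs_of_nonneg (by linarith)]
    ring
  · filter_upwards [hoff] with ω hω
    rw [hω, abs_of_nonpos (by linarith)]
    ring

end RandomVariable

/-- If `0 < R < R₀ := √(2/π)`, then `V = sup_{𝓖 ⊆ σ(X)} u(𝓖) = R²/2 + 1/2`, attained at
`𝓖* = σ(E_{a_R})` where `a_R > 0` is the unique positive number with `I(a_R) = R`. -/
theorem insider_value_small_R {Ω : Type*} {m0 : MeasurableSpace Ω}
    (P : Measure Ω) [IsProbabilityMeasure P]
    (X : Ω → ℝ) (hX : Measurable X)
    (hlaw : P.map X = gaussianReal 0 1)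
    (R : ℝ) (hR0 : 0 < R) (hR1 : R < Real.sqrt (2 / Real.pi)) :
    ∃ aR : ℝ, (0 < aR ∧ Ifun P X aR = R) ∧
      (∀ a : ℝ, 0 < a → Ifun P X a = R → a = aR) ∧
      (∀ G : MeasurableSpace Ω, G ≤ MeasurableSpace.comap X Real.measurableSpace →
        infoValue P X R G ≤ R ^ 2 / 2 + 1 / 2) ∧
      infoValue P X R (MeasurableSpace.generateFrom {Eset X aR}) = R ^ 2 / 2 + 1 / 2 := by
  set c := √(2 / Real.pi)
  have hc : 0 < c := hR0.trans hR1
  have hlaw' : HasLaw X (gaussianReal 0 1) P := ⟨hX.aemeasurable, hlaw⟩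
  have hX2 : MemLp X 2 P := by
    have h := memLp_id_gaussianReal (μ := 0) (v := 1) 2
    rw [← hlaw] at h
    exact h.comp_of_map hX.aemeasurable
  have hmean : ∫ ω, X ω ∂P = 0 := by
    rw [hlaw'.integral_eq, integral_id_gaussianReal]
  have hsq : ∫ ω, X ω ^ 2 ∂P = 1 := by
    have h := variance_eq_sub hX2
    rw [hlaw'.variance_eq, variance_id_gaussianReal, hmean] at h
    simpa using h.symm
  set q := (R / c + 1) / 2 with hq
  have hq0 : 0 < q := by positivity
  have hq1 : q < 1 := by
    have := (div_lt_one hc).2 hR1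
    linarith
  have hlog : Real.log q < 0 := Real.log_neg hq0 hq1
  have hIiff {a : ℝ} (ha : 0 < a) : Ifun P X a = R ↔ a = √(-2 * Real.log q) := by
    rw [Ifun_eq_of_map_eq_gaussianReal hX hlaw ha.le, eq_comm (a := a),
      Real.sqrt_eq_iff_eq_sq (by linarith) ha.le]
    calc c * (2 * Real.exp (-a ^ 2 / 2) - 1) = R ↔ Real.exp (-a ^ 2 / 2) = q := by
          rw [hq]
          field_simp
          constructor <;> intro h <;> linarith
      _ ↔ -a ^ 2 / 2 = Real.log q := by
          rw [← Real.exp_eq_exp (y := Real.log q), Real.exp_log hq0]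
      _ ↔ -2 * Real.log q = a ^ 2 := by
          constructor <;> intro h <;> linarith
  have haR : 0 < √(-2 * Real.log q) := Real.sqrt_pos.2 (by linarith)
  set aR := √(-2 * Real.log q)
  have hI : Ifun P X aR = R := (hIiff haR).2 rfl
  have hE := measurableSet_Eset hX aR
  refine ⟨aR, ⟨haR, hI⟩, fun a ha h ↦ (hIiff ha).1 h, fun G hG ↦ ?_, ?_⟩
  · simpa [hsq] using infoValue_le hX2 R (hG.trans hX.comap_le)
  · have hEid := measurableSet_Eset measurable_id aR
    have hpre : X ⁻¹' Eset id aR = Eset X aR := rfl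
    have hPE : P.real (Eset X aR) = 1 / 2 := by
      rw [← hpre, ← map_measureReal_apply hX hEid, hlaw, measureReal_Eset_gaussianReal haR.le]
    have hintegral : ∫ ω in Eset X aR, X ω ∂P = R / 2 := by
      have h := setIntegral_map (μ := P) (g := X) (f := fun x : ℝ ↦ x) hEid (by fun_prop)
        hX.aemeasurable
      rw [hlaw, setIntegral_Eset_gaussianReal haR.le, hpre] at h
      rw [← h, ← hI, Ifun_eq_of_map_eq_gaussianReal hX hlaw haR.le]
      ring
    rw [infoValue_eq_of_abs_condExp_eq hX2 (MeasurableSpace.generateFrom_singleton_le hE)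
      (abs_condExp_generateFrom_singleton_eq (hX2.integrable one_le_two) hmean hR0.le hE hPE hintegral),
      hsq]
end

section
/- Let X be standard normal and 0 < R < R₀ := √(2/π). A sub-σ-algebra 𝓖 ⊆ σ(X) satisfies E[R·|E[X|𝓖]| + (1/2)·Var(X|𝓖)] = R²/2 + 1/2 (the maximal possible value over all sub-σ-algebras of σ(X)) if and only if |E[X|𝓖]| = R ℙ-almost surely. -/
open MeasureTheory ProbabilityTheory

/-- A standard normal random variable is square integrable. -/
theorem memLp_two_of_map_eq_gaussianReal {Ω : Type*} {m0 : MeasurableSpace Ω}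
    {P : Measure Ω} {X : Ω → ℝ} (hX : Measurable X) (hlaw : P.map X = gaussianReal 0 1) :
    MemLp X 2 P := by
  have hid : MemLp id 2 (P.map X) := hlaw ▸ memLp_id_gaussianReal 2
  exact (memLp_map_measure_iff hid.1 hX.aemeasurable).1 hid

/-- A standard normal random variable has second moment one. -/
theorem integral_sq_eq_one_of_map_eq_gaussianReal {Ω : Type*} {m0 : MeasurableSpace Ω}
    {P : Measure Ω} {X : Ω → ℝ} (hX : Measurable X) (hlaw : P.map X = gaussianReal 0 1) :
    ∫ ω, X ω ^ 2 ∂P = 1 := by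
  have hvar := variance_id_gaussianReal (μ := 0) (v := 1)
  rw [variance_of_integral_eq_zero aemeasurable_id (by simp), ← hlaw,
    integral_map hX.aemeasurable (by fun_prop)] at hvar
  simpa using hvar

/-- The squared distance of `|E[X|𝓖]|` from a constant is integrable for square integrable `X`. -/
theorem integrable_sq_abs_condExp_sub {Ω : Type*} {m0 : MeasurableSpace Ω}
    {P : Measure Ω} [IsProbabilityMeasure P] {X : Ω → ℝ} (hX : MemLp X 2 P) (R : ℝ)
    (G : MeasurableSpace Ω) : Integrable (fun ω => (|(P[X|G]) ω| - R) ^ 2) P := by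
  have hcond : MemLp (P[X|G]) 2 P := hX.condExp one_le_two
  exact (hcond.abs.sub (memLp_const R)).integrable_sq

/-- The information value falls short of `(R² + E[X²])/2` by half the mean squared distance of
`|E[X|𝓖]|` from `R`. -/
theorem infoValue_eq_sub_integral_sq {Ω : Type*} {m0 : MeasurableSpace Ω}
    (P : Measure Ω) [IsProbabilityMeasure P] {X : Ω → ℝ} (hX : MemLp X 2 P) (R : ℝ)
    {G : MeasurableSpace Ω} (hG : G ≤ m0) :
    infoValue P X R G =
      R ^ 2 / 2 + (∫ ω, X ω ^ 2 ∂P) / 2 - (∫ ω, (|(P[X|G]) ω| - R) ^ 2 ∂P) / 2 := by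
  have hsq : Integrable (fun ω => (|(P[X|G]) ω| - R) ^ 2) P :=
    integrable_sq_abs_condExp_sub hX R G
  have hcond : Integrable (P[(fun ω => X ω ^ 2)|G]) P := integrable_condExp
  have hpoint : (fun ω => R * |(P[X|G]) ω| +
      (1 / 2) * ((P[(fun ω' => X ω' ^ 2)|G]) ω - (P[X|G]) ω ^ 2)) =
      fun ω => R ^ 2 / 2 + (P[(fun ω' => X ω' ^ 2)|G]) ω / 2
        - (|(P[X|G]) ω| - R) ^ 2 / 2 := by
    funext ω
    rw [← sq_abs ((P[X|G]) ω)]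
    ring
  rw [infoValue, hpoint, integral_sub (by fun_prop) (hsq.div_const 2),
    integral_add (integrable_const _) (hcond.div_const 2),
    integral_div, integral_div, integral_div, integral_condExp hG]
  simp

/-- For a standard normal `X` and `0 < R < R₀ := √(2/π)`, a sub-σ-algebra `𝓖 ⊆ σ(X)` attains the
maximal value `u(𝓖) = R²/2 + 1/2` if and only if `|E[X|𝓖]| = R` almost surely. -/
theorem insider_optimal_iff {Ω : Type*} {m0 : MeasurableSpace Ω}
    (P : Measure Ω) [IsProbabilityMeasure P]
    (X : Ω → ℝ) (hX : Measurable X)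
    (hlaw : P.map X = gaussianReal 0 1)
    (R : ℝ) (hR0 : 0 < R) (hR1 : R < Real.sqrt (2 / Real.pi))
    (G : MeasurableSpace Ω) (hG : G ≤ MeasurableSpace.comap X Real.measurableSpace) :
    infoValue P X R G = R ^ 2 / 2 + 1 / 2 ↔ ∀ᵐ ω ∂P, |(P[X|G]) ω| = R := by
  have hGm : G ≤ m0 := hG.trans hX.comap_le
  have hX2 : MemLp X 2 P := memLp_two_of_map_eq_gaussianReal hX hlaw
  have hsq : Integrable (fun ω => (|(P[X|G]) ω| - R) ^ 2) P :=
    integrable_sq_abs_condExp_sub hX2 R G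
  have hzero : ∫ ω, (|(P[X|G]) ω| - R) ^ 2 ∂P = 0 ↔ ∀ᵐ ω ∂P, |(P[X|G]) ω| = R := by
    rw [integral_eq_zero_iff_of_nonneg (fun ω => sq_nonneg _) hsq]
    refine Filter.eventually_congr (Filter.Eventually.of_forall fun ω => ?_)
    simp [sub_eq_zero]
  rw [infoValue_eq_sub_integral_sq P hX2 R hGm,
    integral_sq_eq_one_of_map_eq_gaussianReal hX hlaw, ← hzero]
  constructor <;> intro h <;> linarith
end

section
/- Let (Ω, 𝓕, ℙ) be a standard Borel probability space supporting independent random variables U₁ uniform on [0,1] and U₂ uniform on [0,1]^d. Let (pᵢ)_{i ≥ 1} be nonnegative reals with Σᵢ pᵢ = 1 and let (μᵢ)_{i ≥ 1} be probability measures on ℝ^d. Then there exist random variables X : Ω → ℝ^d and Y : Ω → ℝ, with Y measurable with respect to σ(U₁) and taking countably many values with ℙ(Y = yᵢ) = pᵢ, such that ℒ_{ℒ_{X|Y}} = Σᵢ pᵢ · δ_{μᵢ}. -/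
open MeasureTheory ProbabilityTheory

/-- Projecting the uniform law on `[0, 1] ⊆ ℝ` to the unit interval gives its volume. -/
lemma map_projIcc_volume_restrict_Icc :
    ((volume : Measure ℝ).restrict (Set.Icc 0 1)).map (Set.projIcc (0 : ℝ) 1 zero_le_one) =
      (volume : Measure unitInterval) := by
  have hmeas : Measurable (Set.projIcc (0 : ℝ) 1 zero_le_one) := continuous_projIcc.measurable
  have hval : (volume : Measure unitInterval).map Subtype.val =
      (volume : Measure ℝ).restrict (Set.Icc 0 1) :=
    map_comap_subtype_coe measurableSet_Icc volume
  have hid : Set.projIcc (0 : ℝ) 1 zero_le_one ∘ Subtype.val = id := by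
    funext x
    exact Set.projIcc_val zero_le_one x
  rw [← hval, Measure.map_map hmeas measurable_subtype_coe, hid, Measure.map_id]

/-- The uniform law on the cube `[0,1]^d` can be transported to any Markov kernel into `ℝ^d`. -/
lemma exists_measurable_map_uniform_cube_eq {E : Type*} [MeasurableSpace E] (d : ℕ)
    (κ : Kernel E (Fin d → ℝ)) [IsMarkovKernel κ] :
    ∃ F : E → (Fin d → ℝ) → (Fin d → ℝ), Measurable (Function.uncurry F) ∧
      ∀ e, (volume.restrict (Set.univ.pi fun _ : Fin d => Set.Icc (0 : ℝ) 1)).map (F e) = κ e := by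
  have hprob : IsProbabilityMeasure ((volume : Measure ℝ).restrict (Set.Icc 0 1)) :=
    ⟨by simp⟩
  rw [volume_pi, Measure.restrict_pi_pi]
  rcases d with _ | d
  · refine ⟨fun _ u => u, measurable_snd, fun e => ?_⟩
    ext s
    induction s using Subsingleton.set_cases <;> simp
  · obtain ⟨f, hf, hfκ⟩ := κ.exists_measurable_map_eq_unitInterval
    have hproj : Measurable (Set.projIcc (0 : ℝ) 1 zero_le_one) := continuous_projIcc.measurable
    refine ⟨fun e u => f e (Set.projIcc (0 : ℝ) 1 zero_le_one (u 0)),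
      hf.comp (measurable_fst.prodMk (hproj.comp (by fun_prop))), fun e => ?_⟩
    have hfe : Measurable (f e) := hf.of_uncurry_left
    have heval := (measurePreserving_eval
      (fun _ : Fin (d + 1) => (volume : Measure ℝ).restrict (Set.Icc 0 1)) 0).map_eq
    rw [← hfκ e, ← map_projIcc_volume_restrict_Icc, Measure.map_map hfe hproj]
    conv_rhs => rw [← heval, Measure.map_map (hfe.comp hproj) (measurable_pi_apply 0)]
    rfl

/-- If `U` is independent of `Y` and `F e` transports the law of `U` to `κ e`, then `κ` is the
conditional law of `F Y U` given `Y`. -/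
lemma condDistrib_ae_eq_of_indepFun_of_map_eq {Ω E G H : Type*} [MeasurableSpace Ω]
    [MeasurableSpace E] [MeasurableSpace G] [MeasurableSpace H] [StandardBorelSpace H] [Nonempty H]
    {P : Measure Ω} [IsProbabilityMeasure P] {Y : Ω → E} {U : Ω → G}
    (hY : Measurable Y) (hU : Measurable U) (hind : IndepFun Y U P)
    {F : E → G → H} (hF : Measurable (Function.uncurry F))
    (κ : Kernel E H) [IsMarkovKernel κ] (hκ : ∀ e, (P.map U).map (F e) = κ e) :
    condDistrib (fun ω => F (Y ω) (U ω)) Y P =ᵐ[P.map Y] κ := by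
  have hX : Measurable fun ω => F (Y ω) (U ω) := hF.comp (hY.prodMk hU)
  have := Measure.isProbabilityMeasure_map (μ := P) hU.aemeasurable
  refine condDistrib_ae_eq_of_measure_eq_compProd Y hX.aemeasurable ?_
  have hjoint := hind.map_prod_eq_prod_map_map hY.aemeasurable hU.aemeasurable
  have hG : Measurable fun z : E × G => (z.1, F z.1 z.2) := measurable_fst.prodMk hF
  have hcomp : P.map (fun ω => (Y ω, F (Y ω) (U ω))) =
      ((P.map Y).prod (P.map U)).map fun z => (z.1, F z.1 z.2) := by
    rw [← hjoint, Measure.map_map hG (hY.prodMk hU)]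
    rfl
  ext s hs
  rw [hcomp, Measure.map_apply hG hs, Measure.prod_apply (hG hs), Measure.compProd_apply hs]
  refine lintegral_congr fun e => ?_
  rw [← hκ e, Measure.map_apply hF.of_uncurry_left (measurable_prodMk_left hs)]
  rfl

/-- Discrete case: on a standard Borel probability space supporting independent uniforms
`U₁ ~ U([0,1])` and `U₂ ~ U([0,1]^d)`, for nonnegative weights `(pᵢ)` with `Σᵢ pᵢ = 1` and
probability measures `(μᵢ)` on `ℝ^d`, there are `X : Ω → ℝ^d` and a `σ(U₁)`-measurable,
countably-valued `Y : Ω → ℝ` with `ℙ(Y = yᵢ) = pᵢ` such that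
`ℒ_{ℒ_{X|Y}} = Σᵢ pᵢ·δ_{μᵢ}`, where `ℒ_{X|Y}(ω) = condDistrib X Y P (Y ω)`. -/
theorem exists_rv_law_of_conditional_law_discrete (d : ℕ)
    {Ω : Type*} {m0 : MeasurableSpace Ω} [StandardBorelSpace Ω]
    (P : Measure Ω) [IsProbabilityMeasure P]
    (U₁ : Ω → ℝ) (U₂ : Ω → (Fin d → ℝ)) (hU₁ : Measurable U₁) (hU₂ : Measurable U₂)
    (hlaw₁ : P.map U₁ = volume.restrict (Set.Icc (0 : ℝ) 1))
    (hlaw₂ : P.map U₂ = volume.restrict (Set.univ.pi fun _ : Fin d => Set.Icc (0 : ℝ) 1))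
    (hindep : IndepFun U₁ U₂ P)
    (p : ℕ → ℝ) (hp : ∀ i, 0 ≤ p i) (hpsum : ∑' i, p i = 1)
    (μ : ℕ → Measure (Fin d → ℝ)) (hμ : ∀ i, IsProbabilityMeasure (μ i)) :
    ∃ (X : Ω → (Fin d → ℝ)) (Y : Ω → ℝ) (y : ℕ → ℝ),
      Measurable X ∧
      Measurable[MeasurableSpace.comap U₁ Real.measurableSpace] Y ∧
      (∀ ω, ∃ i, Y ω = y i) ∧
      (∀ i, P {ω | Y ω = y i} = ENNReal.ofReal (p i)) ∧
      P.map (fun ω => (condDistrib X Y P) (Y ω)) =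
        Measure.sum (fun i => ENNReal.ofReal (p i) • Measure.dirac (μ i)) := by
  have hpsummable : Summable p := by
    by_contra h
    simp [tsum_eq_zero_of_not_summable h] at hpsum
  set π : Measure ℕ := Measure.sum fun i => ENNReal.ofReal (p i) • Measure.dirac i with hπ
  have hπprob : IsProbabilityMeasure π := ⟨by
    simp [hπ, ← ENNReal.ofReal_tsum_of_nonneg hp hpsummable, hpsum]⟩
  obtain ⟨g, hg, hgπ⟩ := π.exists_measurable_map_eq
  let h : ℝ → ℕ := g ∘ Set.projIcc (0 : ℝ) 1 zero_le_one
  have hproj : Measurable (Set.projIcc (0 : ℝ) 1 zero_le_one) := continuous_projIcc.measurable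
  have hh : Measurable h := hg.comp hproj
  have hN : P.map (h ∘ U₁) = π := by
    rw [← Measure.map_map hh hU₁, hlaw₁, ← Measure.map_map hg hproj,
      map_projIcc_volume_restrict_Icc, hgπ]
  let κ : Kernel ℝ (Fin d → ℝ) :=
    ⟨fun r => μ ⌊r⌋₊, (measurable_of_countable μ).comp Nat.measurable_floor⟩
  have hκ : IsMarkovKernel κ := ⟨fun r => hμ ⌊r⌋₊⟩
  obtain ⟨F, hF, hFκ⟩ := exists_measurable_map_uniform_cube_eq d κ
  let c : ℝ → ℝ := fun u => (h u : ℝ)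
  have hc : Measurable c := (measurable_of_countable (Nat.cast : ℕ → ℝ)).comp hh
  have hY : Measurable (c ∘ U₁) := hc.comp hU₁
  refine ⟨fun ω => F (c (U₁ ω)) (U₂ ω), c ∘ U₁, Nat.cast, hF.comp (hY.prodMk hU₂),
    hc.comp (comap_measurable U₁), fun ω => ⟨h (U₁ ω), rfl⟩, fun i => ?_, ?_⟩
  · have hset : {ω | (c ∘ U₁) ω = (i : ℝ)} = (h ∘ U₁) ⁻¹' {i} := by
      ext ω
      simp [c]
    rw [hset, ← Measure.map_apply (hh.comp hU₁) (measurableSet_singleton i), hN, hπ,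
      Measure.sum_apply _ (measurableSet_singleton i), tsum_eq_single i]
    · simp
    · intro j hj
      simp [hj]
  · have hcond := ae_of_ae_map hY.aemeasurable
      (condDistrib_ae_eq_of_indepFun_of_map_eq hY hU₂ (hindep.comp hc measurable_id) hF κ
        fun e => by rw [hlaw₂, hFκ])
    have hμmeas : Measurable μ := measurable_of_countable μ
    calc P.map (fun ω => condDistrib (fun ω => F (c (U₁ ω)) (U₂ ω)) (c ∘ U₁) P ((c ∘ U₁) ω))
      _ = P.map (μ ∘ (h ∘ U₁)) := by
        refine Measure.map_congr ?_
        filter_upwards [hcond] with ω hω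
        refine hω.trans ?_
        simp [κ, c]
      _ = π.map μ := by rw [← Measure.map_map hμmeas (hh.comp hU₁), hN]
      _ = _ := by
        rw [hπ, Measure.map_sum hμmeas.aemeasurable]
        simp [Measure.map_smul, Measure.map_dirac' hμmeas]
end

section
/- Fix d, n ≥ 1. Let Dₙ := {x ∈ [0,1)^d : 2ⁿx ∈ ℤ^d} be the dyadic grid and, for x ∈ Dₙ, let Δₙ(x) := ∏_{i=1}^d [xᵢ, xᵢ + 2^{−n}) be the corresponding dyadic cube. For a probability measure μ on [0,1)^d, define a measure μₙ supported on Dₙ by μₙ({x}) := 2^{−2dn}·⌊2^{2dn}·μ(Δₙ(x))⌋ for x ∈ Dₙ \ {0} and μₙ({0}) := 1 − Σ_{x ∈ Dₙ \ {0}} μₙ({x}). Then μₙ is a probability measure, 0 ≤ μ(Δₙ(x)) − μₙ({x}) < 2^{−2dn} for every x ∈ Dₙ \ {0}, and there exists a coupling π of μₙ and μ (a probability measure on [0,1)^d × [0,1)^d with marginals μₙ and μ) such that ∫ |x − y|² dπ(x,y) ≤ C·2^{−n}, where C is a constant depending only on d. -/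
open MeasureTheory

/-- The dyadic grid point of `Dₙ = {x ∈ [0,1)^d : 2ⁿx ∈ ℤ^d}` indexed by
`k : Fin d → Fin (2^n)`, namely `x i = k i / 2ⁿ`. -/
noncomputable def gridPt (d n : ℕ) (k : Fin d → Fin (2 ^ n)) : Fin d → ℝ :=
  fun i => (k i : ℝ) / 2 ^ n

/-- The dyadic cube `Δₙ(x) = ∏ᵢ [xᵢ, xᵢ + 2^{−n})`. -/
def dyadicCube (d n : ℕ) (x : Fin d → ℝ) : Set (Fin d → ℝ) :=
  {y | ∀ i, x i ≤ y i ∧ y i < x i + 1 / 2 ^ n}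

/-- The weight `2^{−2dn}·⌊2^{2dn}·μ(Δₙ(x))⌋` at a grid point `x = gridPt d n k`. -/
noncomputable def dyadicWt (d n : ℕ) (μ : Measure (Fin d → ℝ))
    (k : Fin d → Fin (2 ^ n)) : ℝ :=
  (1 / 2 ^ (2 * d * n) : ℝ) *
    ⌊(2 : ℝ) ^ (2 * d * n) * (μ (dyadicCube d n (gridPt d n k))).toReal⌋

open scoped Classical in
/-- The weight of `μₙ`: at nonzero grid points it is `dyadicWt`, and at the origin it is
`1 − Σ_{x ∈ Dₙ \ {0}} μₙ({x})`. -/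
noncomputable def approxWt (d n : ℕ) (μ : Measure (Fin d → ℝ))
    (k : Fin d → Fin (2 ^ n)) : ℝ :=
  if gridPt d n k = 0 then
    1 - ∑ k' ∈ Finset.univ.filter (fun k' => gridPt d n k' ≠ 0), dyadicWt d n μ k'
  else dyadicWt d n μ k

/-- The discretized measure `μₙ`, supported on the dyadic grid `Dₙ`. -/
noncomputable def approxMeas (d n : ℕ) (μ : Measure (Fin d → ℝ)) : Measure (Fin d → ℝ) :=
  ∑ k : Fin d → Fin (2 ^ n), ENNReal.ofReal (approxWt d n μ k) • Measure.dirac (gridPt d n k)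

/-- If the sets `Q i` partition almost all of the space and `w i ≤ μ (Q i)`, then `μ` is coupled to
the measure putting mass `w i` at `x i` and the remaining mass at `o`, by sending the fraction
`w i / μ (Q i)` of each `Q i` to `x i` and the rest of it to `o`. -/
theorem exists_coupling_of_partition {ι E : Type*} [Fintype ι] [MeasurableSpace E]
    (μ : Measure E) [IsFiniteMeasure μ] (Q : ι → Set E) (hQ : ∀ i, MeasurableSet (Q i))
    (hdisj : Pairwise (Function.onFun Disjoint Q)) (hcover : ∀ᵐ y ∂μ, y ∈ ⋃ i, Q i)
    (x : ι → E) (o : E) (w : ι → ENNReal) (hw : ∀ i, w i ≤ μ (Q i)) :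
    ∃ π : Measure (E × E),
      π.map Prod.fst = ∑ i, w i • Measure.dirac (x i) + (∑ i, (μ (Q i) - w i)) • Measure.dirac o ∧
      π.map Prod.snd = μ ∧
      ∀ f : E × E → ENNReal, Measurable f → ∀ a b : ENNReal,
        (∀ i, ∀ y ∈ Q i, f (x i, y) ≤ a) → (∀ i, ∀ y ∈ Q i, f (o, y) ≤ b) →
        ∫⁻ q, f q ∂π ≤ a * ∑ i, w i + b * ∑ i, (μ (Q i) - w i) := by
  set c : ι → ENNReal := fun i => w i / μ (Q i)
  have hc_le (i : ι) : c i ≤ 1 := ENNReal.div_le_of_le_mul (by simpa using hw i)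
  have hc_mul (i : ι) : c i * μ (Q i) = w i :=
    ENNReal.div_mul_cancel' (fun h => le_zero_iff.1 (h ▸ hw i))
      (fun h => absurd h (measure_ne_top μ _))
  have hc_sub (i : ι) : (1 - c i) * μ (Q i) = μ (Q i) - w i := by
    rw [ENNReal.sub_mul (fun _ _ => measure_ne_top μ _), one_mul, hc_mul]
  have hmk (z : E) : Measurable (fun y : E => (z, y)) := measurable_prodMk_left
  refine ⟨∑ i, (c i • (μ.restrict (Q i)).map (fun y => (x i, y)) +
    (1 - c i) • (μ.restrict (Q i)).map (fun y => (o, y))), ?_, ?_, ?_⟩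
  · rw [Measure.map_finset_sum measurable_fst.aemeasurable, Finset.sum_smul,
      ← Finset.sum_add_distrib]
    refine Finset.sum_congr rfl fun i _ => ?_
    rw [Measure.map_add _ _ measurable_fst, Measure.map_smul, Measure.map_smul,
      Measure.map_map measurable_fst (hmk _), Measure.map_map measurable_fst (hmk _)]
    simp only [Function.comp_def, Measure.map_const, Measure.restrict_apply_univ, smul_smul,
      hc_mul, hc_sub]
  · rw [Measure.map_finset_sum measurable_snd.aemeasurable]
    calc _ = ∑ i, μ.restrict (Q i) := by
          refine Finset.sum_congr rfl fun i _ => ?_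
          rw [Measure.map_add _ _ measurable_snd, Measure.map_smul, Measure.map_smul,
            Measure.map_map measurable_snd (hmk _), Measure.map_map measurable_snd (hmk _)]
          simp only [Function.comp_def, Measure.map_id']
          rw [← add_smul, add_tsub_cancel_of_le (hc_le i), one_smul]
      _ = μ.restrict (⋃ i, Q i) := by
          rw [Measure.restrict_iUnion hdisj hQ, Measure.sum_fintype]
      _ = μ := Measure.restrict_eq_self_of_ae_mem hcover
  · intro f hf a b ha hb
    have hbound (z : E) (i : ι) (m : ENNReal) (h : ∀ y ∈ Q i, f (z, y) ≤ m) :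
        ∫⁻ q, f q ∂(μ.restrict (Q i)).map (fun y => (z, y)) ≤ m * μ (Q i) := by
      rw [lintegral_map hf (hmk z)]
      exact (setLIntegral_mono measurable_const h).trans_eq (setLIntegral_const _ _)
    rw [lintegral_finsetSum_measure, Finset.mul_sum, Finset.mul_sum, ← Finset.sum_add_distrib]
    refine Finset.sum_le_sum fun i _ => ?_
    rw [lintegral_add_measure, lintegral_smul_measure, lintegral_smul_measure, smul_eq_mul,
      smul_eq_mul, ← hc_sub, ← hc_mul, mul_left_comm, mul_left_comm b]
    gcongr
    · exact hbound _ _ _ (ha i)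
    · exact hbound _ _ _ (hb i)

theorem mem_dyadicCube_gridPt {d n : ℕ} {k : Fin d → Fin (2 ^ n)} {y : Fin d → ℝ} :
    y ∈ dyadicCube d n (gridPt d n k) ↔
      ∀ i, ((k i : ℕ) : ℝ) ≤ 2 ^ n * y i ∧ 2 ^ n * y i < (k i : ℕ) + 1 := by
  have h2 : (0 : ℝ) < 2 ^ n := by positivity
  refine forall_congr' fun i => and_congr ?_ ?_
  · rw [gridPt, div_le_iff₀' h2]
  · rw [gridPt, ← add_div, lt_div_iff₀' h2]

theorem measurableSet_dyadicCube (d n : ℕ) (x : Fin d → ℝ) : MeasurableSet (dyadicCube d n x) := by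
  have : dyadicCube d n x = Set.univ.pi fun i => Set.Ico (x i) (x i + 1 / 2 ^ n) := by
    ext y
    simp [dyadicCube]
  rw [this]
  exact MeasurableSet.univ_pi fun i => measurableSet_Ico

theorem pairwise_disjoint_dyadicCube (d n : ℕ) :
    Pairwise (Function.onFun Disjoint fun k => dyadicCube d n (gridPt d n k)) := by
  intro k l hkl
  refine Set.disjoint_left.2 fun y hk hl => hkl (funext fun i => Fin.ext ?_)
  obtain ⟨hk1, hk2⟩ := mem_dyadicCube_gridPt.1 hk i
  obtain ⟨hl1, hl2⟩ := mem_dyadicCube_gridPt.1 hl i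
  have h1 : (k i : ℕ) < (l i : ℕ) + 1 := by exact_mod_cast hk1.trans_lt hl2
  have h2 : (l i : ℕ) < (k i : ℕ) + 1 := by exact_mod_cast hl1.trans_lt hk2
  omega

theorem unitCube_subset_iUnion_dyadicCube (d n : ℕ) :
    (Set.univ.pi fun _ : Fin d => Set.Ico (0 : ℝ) 1) ⊆
      ⋃ k, dyadicCube d n (gridPt d n k) := by
  intro y hy
  have h2 : (0 : ℝ) < 2 ^ n := by positivity
  have hy0 (i : Fin d) : 0 ≤ 2 ^ n * y i := mul_nonneg h2.le (hy i trivial).1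
  refine Set.mem_iUnion.2 ⟨fun i => ⟨⌊2 ^ n * y i⌋₊, ?_⟩, mem_dyadicCube_gridPt.2 fun i =>
    ⟨Nat.floor_le (hy0 i), Nat.lt_floor_add_one _⟩⟩
  rw [Nat.floor_lt (hy0 i)]
  push_cast
  nlinarith [(hy i trivial).2]

theorem dyadicCube_gridPt_subset_unitCube (d n : ℕ) (k : Fin d → Fin (2 ^ n)) :
    dyadicCube d n (gridPt d n k) ⊆ Set.univ.pi fun _ : Fin d => Set.Ico (0 : ℝ) 1 := by
  intro y hy i _
  obtain ⟨h1, h3⟩ := mem_dyadicCube_gridPt.1 hy i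
  have h2 : (0 : ℝ) < 2 ^ n := by positivity
  have hk : ((k i : ℕ) : ℝ) + 1 ≤ 2 ^ n := by exact_mod_cast (k i).isLt
  have hk0 : (0 : ℝ) ≤ (k i : ℕ) := Nat.cast_nonneg _
  exact ⟨nonneg_of_mul_nonneg_right (hk0.trans h1) h2, by nlinarith⟩

theorem norm_gridPt_sub_le {d n : ℕ} {k : Fin d → Fin (2 ^ n)} {y : Fin d → ℝ}
    (hy : y ∈ dyadicCube d n (gridPt d n k)) : ‖gridPt d n k - y‖ ≤ 1 / 2 ^ n := by
  refine (pi_norm_le_iff_of_nonneg (by positivity)).2 fun i => ?_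
  rw [Pi.sub_apply, Real.norm_eq_abs, abs_le]
  constructor <;> linarith [(hy i).1, (hy i).2, (by positivity : (0 : ℝ) ≤ 1 / 2 ^ n)]

theorem norm_le_one_of_mem_unitCube {d : ℕ} {y : Fin d → ℝ}
    (hy : y ∈ Set.univ.pi fun _ : Fin d => Set.Ico (0 : ℝ) 1) : ‖y‖ ≤ 1 := by
  refine (pi_norm_le_iff_of_nonneg zero_le_one).2 fun i => ?_
  rw [Real.norm_eq_abs, abs_of_nonneg (hy i trivial).1]
  exact (hy i trivial).2.le

theorem gridPt_eq_zero_iff {d n : ℕ} {k : Fin d → Fin (2 ^ n)} : gridPt d n k = 0 ↔ k = 0 := by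
  refine funext_iff.trans (Iff.trans (forall_congr' fun i => ?_) funext_iff.symm)
  rw [gridPt, Pi.zero_apply, div_eq_zero_iff, or_iff_left (by positivity), Nat.cast_eq_zero,
    Pi.zero_apply, Fin.ext_iff, Fin.val_zero]

theorem dyadicWt_nonneg (d n : ℕ) (μ : Measure (Fin d → ℝ)) (k : Fin d → Fin (2 ^ n)) :
    0 ≤ dyadicWt d n μ k := by
  have : 0 ≤ ⌊(2 : ℝ) ^ (2 * d * n) * (μ (dyadicCube d n (gridPt d n k))).toReal⌋ :=
    Int.floor_nonneg.2 (by positivity)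
  unfold dyadicWt
  positivity

theorem dyadicWt_le (d n : ℕ) (μ : Measure (Fin d → ℝ)) (k : Fin d → Fin (2 ^ n)) :
    dyadicWt d n μ k ≤ (μ (dyadicCube d n (gridPt d n k))).toReal := by
  rw [dyadicWt, one_div, inv_mul_le_iff₀ (by positivity)]
  exact Int.floor_le _

theorem sub_dyadicWt_lt (d n : ℕ) (μ : Measure (Fin d → ℝ)) (k : Fin d → Fin (2 ^ n)) :
    (μ (dyadicCube d n (gridPt d n k))).toReal - dyadicWt d n μ k < 1 / 2 ^ (2 * d * n) := by
  rw [sub_lt_iff_lt_add', dyadicWt, ← mul_add_one, one_div, lt_inv_mul_iff₀ (by positivity)]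
  exact Int.lt_floor_add_one _

theorem sum_measure_dyadicCube {d n : ℕ} {μ : Measure (Fin d → ℝ)} [IsProbabilityMeasure μ]
    (hμ : μ (Set.univ.pi fun _ : Fin d => Set.Ico (0 : ℝ) 1) = 1) :
    ∑ k, (μ (dyadicCube d n (gridPt d n k))).toReal = 1 := by
  rw [← ENNReal.toReal_sum fun _ _ => measure_ne_top μ _, ← tsum_fintype (L := .unconditional _),
    ← measure_iUnion (pairwise_disjoint_dyadicCube d n) fun k => measurableSet_dyadicCube d n _,
    le_antisymm prob_le_one (hμ.symm.trans_le
      (measure_mono (unitCube_subset_iUnion_dyadicCube d n))), ENNReal.toReal_one]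

/-- `μₙ` puts mass `dyadicWt` at every grid point and the total rounding defect at the origin. -/
theorem approxMeas_eq {d n : ℕ} {μ : Measure (Fin d → ℝ)} [IsProbabilityMeasure μ]
    (hμ : μ (Set.univ.pi fun _ : Fin d => Set.Ico (0 : ℝ) 1) = 1) :
    approxMeas d n μ =
      ∑ k, ENNReal.ofReal (dyadicWt d n μ k) • Measure.dirac (gridPt d n k) +
        (∑ k, (μ (dyadicCube d n (gridPt d n k)) - ENNReal.ofReal (dyadicWt d n μ k))) •
          Measure.dirac 0 := by
  have hsub (k : Fin d → Fin (2 ^ n)) :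
      μ (dyadicCube d n (gridPt d n k)) - ENNReal.ofReal (dyadicWt d n μ k) =
        ENNReal.ofReal ((μ (dyadicCube d n (gridPt d n k))).toReal - dyadicWt d n μ k) := by
    rw [ENNReal.ofReal_sub _ (dyadicWt_nonneg d n μ k), ENNReal.ofReal_toReal (measure_ne_top μ _)]
  have hdef (k : Fin d → Fin (2 ^ n)) :
      0 ≤ (μ (dyadicCube d n (gridPt d n k))).toReal - dyadicWt d n μ k :=
    sub_nonneg.2 (dyadicWt_le d n μ k)
  have hgrid : gridPt d n 0 = 0 := gridPt_eq_zero_iff.2 rfl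
  have hwt_zero : approxWt d n μ 0 = dyadicWt d n μ 0 +
      ∑ k, ((μ (dyadicCube d n (gridPt d n k))).toReal - dyadicWt d n μ k) := by
    classical
    rw [approxWt, if_pos hgrid, Finset.sum_sub_distrib, sum_measure_dyadicCube hμ,
      ← Finset.add_sum_erase _ _ (Finset.mem_univ (0 : Fin d → Fin (2 ^ n)))]
    have : Finset.univ.filter (fun k => gridPt d n k ≠ 0) = Finset.univ.erase 0 := by
      ext k
      simp [gridPt_eq_zero_iff]
    rw [this]
    ring
  have hwt {k : Fin d → Fin (2 ^ n)} (hk : k ≠ 0) : approxWt d n μ k = dyadicWt d n μ k :=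
    if_neg (mt gridPt_eq_zero_iff.1 hk)
  classical
  rw [approxMeas, ← Finset.add_sum_erase _ _ (Finset.mem_univ (0 : Fin d → Fin (2 ^ n))),
    ← Finset.add_sum_erase _ (fun k => ENNReal.ofReal (dyadicWt d n μ k) • _)
      (Finset.mem_univ (0 : Fin d → Fin (2 ^ n))),
    Finset.sum_congr rfl fun k hk => by rw [hwt (Finset.ne_of_mem_erase hk)], hwt_zero,
    ENNReal.ofReal_add (dyadicWt_nonneg d n μ 0) (Finset.sum_nonneg fun k _ => hdef k), add_smul,
    ENNReal.ofReal_sum_of_nonneg fun k _ => hdef k, Finset.sum_congr rfl fun k _ => hsub k, hgrid,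
    add_right_comm]

/-- For every probability measure `μ` on `[0,1)^d`, the discretization `μₙ` is a probability
measure, its weights satisfy `0 ≤ μ(Δₙ(x)) − μₙ({x}) < 2^{−2dn}` at every nonzero grid point,
and there is a coupling `π` of `μₙ` and `μ` with `∫ |x−y|² dπ ≤ C·2^{−n}`, where the constant
`C` depends only on `d`. -/
theorem dyadic_approximation_wasserstein (d : ℕ) (hd : 1 ≤ d) :
    ∃ C : ℝ, 0 < C ∧ ∀ n : ℕ, 1 ≤ n →
      ∀ μ : Measure (Fin d → ℝ), IsProbabilityMeasure μ →
        μ (Set.univ.pi fun _ : Fin d => Set.Ico (0 : ℝ) 1) = 1 →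
        IsProbabilityMeasure (approxMeas d n μ) ∧
        (∀ k : Fin d → Fin (2 ^ n), gridPt d n k ≠ 0 →
          0 ≤ (μ (dyadicCube d n (gridPt d n k))).toReal - approxWt d n μ k ∧
            (μ (dyadicCube d n (gridPt d n k))).toReal - approxWt d n μ k
              < 1 / 2 ^ (2 * d * n)) ∧
        ∃ π : Measure ((Fin d → ℝ) × (Fin d → ℝ)),
          π.map Prod.fst = approxMeas d n μ ∧ π.map Prod.snd = μ ∧
          ∫ q, ‖q.1 - q.2‖ ^ 2 ∂π ≤ C / 2 ^ n := by
  refine ⟨2, two_pos, fun n hn μ _ hμ => ?_⟩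
  obtain ⟨π, hfst, hsnd, hcost⟩ := exists_coupling_of_partition μ
    (fun k => dyadicCube d n (gridPt d n k)) (fun k => measurableSet_dyadicCube d n _)
    (pairwise_disjoint_dyadicCube d n)
    (Filter.mem_of_superset ((mem_ae_iff_prob_eq_one
      (MeasurableSet.univ_pi fun _ => measurableSet_Ico)).2 hμ)
      (unitCube_subset_iUnion_dyadicCube d n))
    (gridPt d n) 0 (fun k => ENNReal.ofReal (dyadicWt d n μ k))
    (fun k => ENNReal.ofReal_le_of_le_toReal (dyadicWt_le d n μ k))
  rw [← approxMeas_eq hμ] at hfst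
  have hπ : IsProbabilityMeasure π := by
    refine ⟨?_⟩
    rw [← Set.preimage_univ (f := Prod.snd), ← Measure.map_apply measurable_snd .univ, hsnd,
      measure_univ]
  refine ⟨hfst ▸ Measure.isProbabilityMeasure_map measurable_fst.aemeasurable, ?_,
    π, hfst, hsnd, ?_⟩
  · intro k hk
    rw [approxWt, if_neg hk]
    exact ⟨sub_nonneg.2 (dyadicWt_le d n μ k), sub_dyadicWt_lt d n μ k⟩
  have hsum_le : ∑ k, ENNReal.ofReal (dyadicWt d n μ k) ≤ 1 := by
    rw [← ENNReal.ofReal_sum_of_nonneg fun k _ => dyadicWt_nonneg d n μ k, ENNReal.ofReal_le_one,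
      ← sum_measure_dyadicCube (n := n) hμ]
    exact Finset.sum_le_sum fun k _ => dyadicWt_le d n μ k
  have hdef_le : ∑ k, (μ (dyadicCube d n (gridPt d n k)) - ENNReal.ofReal (dyadicWt d n μ k)) ≤
      ENNReal.ofReal (1 / 2 ^ n) := by
    calc _ ≤ ∑ _k : Fin d → Fin (2 ^ n), ENNReal.ofReal (1 / 2 ^ (2 * d * n)) := by
          refine Finset.sum_le_sum fun k _ => ?_
          rw [← ENNReal.ofReal_toReal (measure_ne_top μ (dyadicCube d n (gridPt d n k))),
            ← ENNReal.ofReal_sub _ (dyadicWt_nonneg d n μ k)]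
          exact ENNReal.ofReal_le_ofReal (sub_dyadicWt_lt d n μ k).le
      _ = ENNReal.ofReal (1 / 2 ^ (d * n)) := by
          rw [← ENNReal.ofReal_sum_of_nonneg fun _ _ => by positivity]
          congr 1
          simp only [Finset.sum_const, Finset.card_univ, Fintype.card_pi, Fintype.card_fin,
            Finset.prod_const, nsmul_eq_mul, Nat.cast_pow, Nat.cast_ofNat, ← pow_mul]
          rw [mul_assoc 2 d n, two_mul, pow_add, mul_comm n d]
          field_simp
      _ ≤ ENNReal.ofReal (1 / 2 ^ n) := by
          gcongr
          · norm_num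
          · exact Nat.le_mul_of_pos_left n hd
  have hmeas : Measurable fun q : (Fin d → ℝ) × (Fin d → ℝ) => ‖q.1 - q.2‖ ^ 2 := by fun_prop
  rw [integral_eq_lintegral_of_nonneg_ae (ae_of_all _ fun q => by positivity)
    hmeas.aestronglyMeasurable]
  refine ENNReal.toReal_le_of_le_ofReal (by positivity) ?_
  have hpow : (1 / 2 ^ n : ℝ) ≤ 1 := div_le_one_of_le₀ (one_le_pow₀ one_le_two) (by positivity)
  calc _ ≤ ENNReal.ofReal (1 / 2 ^ n) * ∑ k, ENNReal.ofReal (dyadicWt d n μ k) +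
        1 * ∑ k, (μ (dyadicCube d n (gridPt d n k)) - ENNReal.ofReal (dyadicWt d n μ k)) := by
        refine hcost _ hmeas.ennreal_ofReal _ _ (fun k y hy => ENNReal.ofReal_le_ofReal ?_)
          (fun k y hy => ENNReal.ofReal_le_one.2 ?_)
        · have h := norm_gridPt_sub_le hy
          exact (pow_le_of_le_one (norm_nonneg _) (h.trans hpow) two_ne_zero).trans h
        · rw [zero_sub, norm_neg]
          exact pow_le_one₀ (norm_nonneg _)
            (norm_le_one_of_mem_unitCube (dyadicCube_gridPt_subset_unitCube d n k hy))
    _ ≤ ENNReal.ofReal (1 / 2 ^ n) * 1 + 1 * ENNReal.ofReal (1 / 2 ^ n) := by gcongr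
    _ = ENNReal.ofReal (2 / 2 ^ n) := by
        rw [mul_one, one_mul, ← ENNReal.ofReal_add (by positivity) (by positivity)]
        congr 1
        ring
end

section
/- Let X₁ and X₂ be independent random variables on a probability space (Ω, 𝓕, ℙ) with ℙ(Xᵢ = 1) = ℙ(Xᵢ = 0) = 1/2 for i = 1, 2, and let C := {X₁ = X₂}. Then: (i) the σ-algebra σ(C) is independent of σ(X₁); (ii) σ(C) ∨ σ(X₂) = σ(X₁, X₂) (indeed X₁ = X₂·1_C + (1 − X₂)·1_{C^c}), and σ(C) ∨ σ(X₂) is NOT independent of σ(X₁); in particular, σ(C) ∨ σ(X₂) is not contained in σ(X₂) up to null sets. (This shows the (H)-hypothesis does not imply the (H*)-hypothesis.) -/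
open MeasureTheory ProbabilityTheory

/-- The σ-algebra generated by a `{0, 1}`-valued random variable is generated by `{X = 1}`. -/
lemma comap_eq_generateFrom_of_zero_or_one {Ω : Type*} {X : Ω → ℝ}
    (hX : ∀ ω, X ω = 0 ∨ X ω = 1) :
    MeasurableSpace.comap X Real.measurableSpace =
      MeasurableSpace.generateFrom {{ω | X ω = 1}} := by
  apply le_antisymm
  · rw [← measurable_iff_comap_le]
    have h : X = Set.indicator {ω | X ω = 1} (fun _ => (1 : ℝ)) := by
      funext ω
      rcases hX ω with h | h <;> simp [Set.indicator, h]
    have hm : MeasurableSet[MeasurableSpace.generateFrom {{ω | X ω = 1}}] {ω | X ω = 1} :=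
      MeasurableSpace.measurableSet_generateFrom rfl
    have hconst : Measurable[MeasurableSpace.generateFrom {{ω | X ω = 1}}]
        (fun _ : Ω => (1 : ℝ)) := measurable_const
    have hmeas := hconst.indicator hm
    rwa [← h] at hmeas
  · refine MeasurableSpace.generateFrom_le ?_
    rintro _ rfl
    exact ⟨{1}, measurableSet_singleton 1, rfl⟩

lemma ENNReal.one_half_mul_one_half_ne : (1 / 2 : ENNReal) * (1 / 2) ≠ 1 / 2 := by
  intro h
  have := congrArg ENNReal.toReal h
  norm_num [ENNReal.toReal_mul] at this

/-- An event of probability `1/2` is not almost surely equal to an event independent of it. -/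
lemma not_ae_eq_of_measure_inter_eq_mul {Ω : Type*} {m0 : MeasurableSpace Ω} {P : Measure Ω}
    {A B : Set Ω} (hA : P A = 1 / 2) (hAB : P (A ∩ B) = P A * P B) : ¬ A =ᵐ[P] B := by
  intro h
  have hinter : (A ∩ B : Set Ω) =ᵐ[P] A := by
    simpa using (Filter.EventuallyEq.refl (ae P) A).inter h.symm
  rw [measure_congr hinter, ← measure_congr h, hA] at hAB
  exact ENNReal.one_half_mul_one_half_ne hAB.symm

/-- The counterexample showing the (H)-hypothesis does not imply the (H*)-hypothesis.
For independent Bernoulli(1/2) random variables `X₁, X₂` and `C = {X₁ = X₂}`: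
(i) `σ(C)` is independent of `σ(X₁)`;
(ii) `σ(C) ∨ σ(X₂) = σ(X₁, X₂)`, indeed `X₁ = X₂·1_C + (1 − X₂)·1_{Cᶜ}` pointwise,
`σ(C) ∨ σ(X₂)` is not independent of `σ(X₁)`, and `σ(C) ∨ σ(X₂)` is not contained in `σ(X₂)`
up to null sets. -/
theorem H_hypothesis_not_Hstar {Ω : Type*} {m0 : MeasurableSpace Ω}
    (P : Measure Ω) [IsProbabilityMeasure P]
    (X₁ X₂ : Ω → ℝ) (hX₁ : Measurable X₁) (hX₂ : Measurable X₂)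
    (hindep : IndepFun X₁ X₂ P)
    (hval₁ : ∀ ω, X₁ ω = 0 ∨ X₁ ω = 1) (hval₂ : ∀ ω, X₂ ω = 0 ∨ X₂ ω = 1)
    (h₁0 : P {ω | X₁ ω = 0} = 1 / 2) (h₁1 : P {ω | X₁ ω = 1} = 1 / 2)
    (h₂0 : P {ω | X₂ ω = 0} = 1 / 2) (h₂1 : P {ω | X₂ ω = 1} = 1 / 2) :
    Indep (MeasurableSpace.generateFrom {{ω | X₁ ω = X₂ ω}})
      (MeasurableSpace.comap X₁ Real.measurableSpace) P ∧
    (MeasurableSpace.generateFrom {{ω | X₁ ω = X₂ ω}} ⊔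
        MeasurableSpace.comap X₂ Real.measurableSpace =
      MeasurableSpace.comap (fun ω => (X₁ ω, X₂ ω)) Prod.instMeasurableSpace) ∧
    (∀ ω, X₁ ω =
      X₂ ω * Set.indicator {ω | X₁ ω = X₂ ω} (fun _ => (1 : ℝ)) ω +
        (1 - X₂ ω) * Set.indicator {ω | X₁ ω = X₂ ω}ᶜ (fun _ => (1 : ℝ)) ω) ∧
    ¬ Indep (MeasurableSpace.generateFrom {{ω | X₁ ω = X₂ ω}} ⊔
        MeasurableSpace.comap X₂ Real.measurableSpace)
      (MeasurableSpace.comap X₁ Real.measurableSpace) P ∧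
    ¬ (∀ B : Set Ω,
        MeasurableSet[MeasurableSpace.generateFrom {{ω | X₁ ω = X₂ ω}} ⊔
          MeasurableSpace.comap X₂ Real.measurableSpace] B →
        ∃ B' : Set Ω, MeasurableSet[MeasurableSpace.comap X₂ Real.measurableSpace] B' ∧
          P (symmDiff B B') = 0) := by
  have hC : MeasurableSet {ω | X₁ ω = X₂ ω} := measurableSet_eq_fun hX₁ hX₂
  have hjoint : ∀ a b : ℝ, P ({ω | X₁ ω = a} ∩ {ω | X₂ ω = b}) =
      P {ω | X₁ ω = a} * P {ω | X₂ ω = b} := fun a b =>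
    hindep.measure_inter_preimage_eq_mul {a} {b}
      (measurableSet_singleton a) (measurableSet_singleton b)
  have hformula : ∀ ω, X₁ ω =
      X₂ ω * Set.indicator {ω | X₁ ω = X₂ ω} (fun _ => (1 : ℝ)) ω +
        (1 - X₂ ω) * Set.indicator {ω | X₁ ω = X₂ ω}ᶜ (fun _ => (1 : ℝ)) ω := by
    intro ω
    rcases hval₁ ω with h | h <;> rcases hval₂ ω with h' | h' <;> simp [Set.indicator, h, h']
  have hsup : MeasurableSpace.generateFrom {{ω | X₁ ω = X₂ ω}} ⊔
        MeasurableSpace.comap X₂ Real.measurableSpace =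
      MeasurableSpace.comap (fun ω => (X₁ ω, X₂ ω)) Prod.instMeasurableSpace := by
    apply le_antisymm
    · refine sup_le (MeasurableSpace.generateFrom_le ?_) ?_
      · rintro _ rfl
        exact ⟨{p | p.1 = p.2}, measurableSet_eq_fun measurable_fst measurable_snd, rfl⟩
      · rw [← measurable_iff_comap_le]
        exact measurable_snd.comp (comap_measurable _)
    · rw [← measurable_iff_comap_le]
      set m := MeasurableSpace.generateFrom {{ω | X₁ ω = X₂ ω}} ⊔
        MeasurableSpace.comap X₂ Real.measurableSpace
      have hX₂m : Measurable[m] X₂ := (comap_measurable X₂).mono le_sup_right le_rfl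
      have hCm : MeasurableSet[m] {ω | X₁ ω = X₂ ω} :=
        le_sup_left (a := MeasurableSpace.generateFrom {{ω | X₁ ω = X₂ ω}}) _
          (MeasurableSpace.measurableSet_generateFrom rfl)
      have hconst : Measurable[m] (fun _ : Ω => (1 : ℝ)) := measurable_const
      have hX₁m : Measurable[m] X₁ := by
        rw [show X₁ = _ from funext hformula]
        exact (hX₂m.mul (hconst.indicator hCm)).add
          ((hconst.sub hX₂m).mul (hconst.indicator hCm.compl))
      exact hX₁m.prodMk hX₂m
  have hA₁ : MeasurableSet[MeasurableSpace.comap X₁ Real.measurableSpace] {ω | X₁ ω = 1} :=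
    ⟨{1}, measurableSet_singleton 1, rfl⟩
  have hA : MeasurableSet[MeasurableSpace.generateFrom {{ω | X₁ ω = X₂ ω}} ⊔
      MeasurableSpace.comap X₂ Real.measurableSpace] {ω | X₁ ω = 1} := by
    rw [hsup]
    exact ⟨{p | p.1 = 1}, measurable_fst (measurableSet_singleton 1), rfl⟩
  refine ⟨?_, hsup, hformula, fun h => ?_, fun h => ?_⟩
  · rw [comap_eq_generateFrom_of_zero_or_one hval₁]
    have hmeas₁ : MeasurableSet {ω | X₁ ω = 1} := hX₁ (measurableSet_singleton 1)
    refine (indepSet_iff_measure_inter_eq_mul hC hmeas₁ P).2 ?_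
    have hinter : {ω | X₁ ω = X₂ ω} ∩ {ω | X₁ ω = 1} = {ω | X₁ ω = 1} ∩ {ω | X₂ ω = 1} := by
      ext ω
      simp only [Set.mem_inter_iff, Set.mem_ofPred_eq]
      grind
    have hdiff : {ω | X₁ ω = X₂ ω} \ {ω | X₁ ω = 1} = {ω | X₁ ω = 0} ∩ {ω | X₂ ω = 0} := by
      ext ω
      simp only [Set.mem_inter_iff, Set.mem_sdiff, Set.mem_ofPred_eq]
      grind
    rw [← measure_inter_add_sdiff {ω | X₁ ω = X₂ ω} hmeas₁, hinter, hdiff, hjoint, hjoint,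
      h₁0, h₁1, h₂0, h₂1, ← mul_add, ENNReal.add_halves, mul_one]
  · exact not_ae_eq_of_measure_inter_eq_mul h₁1 ((Indep_iff _ _ P).1 h _ _ hA hA₁)
      Filter.EventuallyEq.rfl
  · obtain ⟨B, hB, hAB⟩ := h _ hA
    exact not_ae_eq_of_measure_inter_eq_mul h₁1 ((Indep_iff _ _ P).1 hindep _ _ hA₁ hB)
      (measure_symmDiff_eq_zero_iff.1 hAB)
end

section
/- Let ξ be a standard normal random variable on (Ω, 𝓕, ℙ) and λ ∈ ℝ. For a sub-σ-algebra 𝓖 ⊆ σ(ξ), let J₁*(𝓖) := (1/4)·E[ξ²] + (3/4 − λ)·E[(E[ξ|𝓖])²] (Player 1's equilibrium value when sharing the information 𝓖). Then: if λ ≥ 3/4, the supremum of J₁*(𝓖) over all sub-σ-algebras 𝓖 ⊆ σ(ξ) equals 1/4 and is attained at the trivial σ-algebra 𝓖 = {∅, Ω}; if λ ≤ 3/4, the supremum equals 1 − λ and is attained at 𝓖 = σ(ξ). -/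
open MeasureTheory ProbabilityTheory

/-- Player 1's equilibrium value when sharing the information `𝓖`:
`J₁*(𝓖) = (1/4)·E[ξ²] + (3/4 − λ)·E[(E[ξ|𝓖])²]`. -/
noncomputable def eqValue {Ω : Type*} {m0 : MeasurableSpace Ω} (P : Measure Ω) (ξ : Ω → ℝ)
    (lam : ℝ) (G : MeasurableSpace Ω) : ℝ :=
  (1 / 4) * (∫ ω, (ξ ω) ^ 2 ∂P) + (3 / 4 - lam) * ∫ ω, ((P[ξ|G]) ω) ^ 2 ∂P

/-- Conditional expectation does not increase the second moment. -/
theorem integral_sq_condExp_le {Ω : Type*} {m m0 : MeasurableSpace Ω} {P : Measure Ω}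
    [IsFiniteMeasure P] (hm : m ≤ m0) {X : Ω → ℝ} (hX : MemLp X 2 P) :
    ∫ ω, ((P[X|m]) ω) ^ 2 ∂P ≤ ∫ ω, (X ω) ^ 2 ∂P := by
  have hle : ∀ᵐ ω ∂P, ((P[X|m]) ω) ^ 2 ≤ (P[X ^ 2|m]) ω := by
    have hnonneg : 0 ≤ᵐ[P] P[(X - P[X|m]) ^ 2|m] :=
      condExp_nonneg (.of_forall fun ω => sq_nonneg ((X - P[X|m]) ω))
    filter_upwards [hnonneg, condVar_ae_eq_condExp_sq_sub_sq_condExp hm hX] with ω h₀ h₁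
    rw [condVar] at h₁
    simp only [Pi.zero_apply, Pi.sub_apply, Pi.pow_apply] at h₀ h₁
    linarith
  calc ∫ ω, ((P[X|m]) ω) ^ 2 ∂P ≤ ∫ ω, (P[X ^ 2|m]) ω ∂P :=
        integral_mono_ae (hX.condExp one_le_two).integrable_sq integrable_condExp hle
    _ = ∫ ω, (X ω) ^ 2 ∂P := integral_condExp hm

/-- For a standard normal `ξ`: if `λ ≥ 3/4`, the supremum of `J₁*(𝓖)` over sub-σ-algebras
`𝓖 ⊆ σ(ξ)` equals `1/4`, attained at the trivial σ-algebra; if `λ ≤ 3/4`, it equals `1 − λ`,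
attained at `σ(ξ)`. -/
theorem optimal_information_sharing {Ω : Type*} {m0 : MeasurableSpace Ω}
    (P : Measure Ω) [IsProbabilityMeasure P]
    (ξ : Ω → ℝ) (hξ : Measurable ξ) (hlaw : P.map ξ = gaussianReal 0 1) (lam : ℝ) :
    ((3 / 4 : ℝ) ≤ lam →
      (∀ G : MeasurableSpace Ω, G ≤ MeasurableSpace.comap ξ Real.measurableSpace →
        eqValue P ξ lam G ≤ 1 / 4) ∧
      eqValue P ξ lam ⊥ = 1 / 4) ∧
    (lam ≤ (3 / 4 : ℝ) →
      (∀ G : MeasurableSpace Ω, G ≤ MeasurableSpace.comap ξ Real.measurableSpace →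
        eqValue P ξ lam G ≤ 1 - lam) ∧
      eqValue P ξ lam (MeasurableSpace.comap ξ Real.measurableSpace) = 1 - lam) := by
  have hlaw' : HasLaw ξ (gaussianReal 0 1) P := ⟨hξ.aemeasurable, hlaw⟩
  have hL2 : MemLp ξ 2 P := by
    have h : MemLp id 2 (P.map ξ) := hlaw ▸ memLp_id_gaussianReal 2
    exact h.comp_of_map hξ.aemeasurable
  have hmean : ∫ ω, ξ ω ∂P = 0 := by
    rw [hlaw'.integral_eq, integral_id_gaussianReal]
  have hsq : ∫ ω, (ξ ω) ^ 2 ∂P = 1 := by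
    rw [← variance_of_integral_eq_zero hξ.aemeasurable hmean, hlaw'.variance_eq]
    simp
  have hσ : MeasurableSpace.comap ξ Real.measurableSpace ≤ m0 := hξ.comap_le
  refine ⟨fun hlam => ⟨fun G _ => ?_, ?_⟩, fun hlam => ⟨fun G hG => ?_, ?_⟩⟩
  · have h : 0 ≤ ∫ ω, ((P[ξ|G]) ω) ^ 2 ∂P := integral_nonneg fun ω => sq_nonneg _
    rw [eqValue, hsq]
    nlinarith
  · rw [eqValue, hsq, condExp_bot, hmean]
    simp
  · have h := integral_sq_condExp_le (hG.trans hσ) hL2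
    rw [hsq] at h
    rw [eqValue, hsq]
    nlinarith
  · rw [eqValue, condExp_of_stronglyMeasurable hσ (comap_measurable ξ).stronglyMeasurable
      (hL2.integrable one_le_two), hsq]
    ring
end
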